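/- arXiv:2408.15369 — 3 statements merged into one kernel-verified Lean document; each statement's English description precedes it below -/
import Mathlib

section
/- Let P be a positive random field on X^{ℤ^d} and F = (Λ_n) a filtration. Let I ⊆ V be finite nonempty subsets of ℤ^d, let x̄ ∈ 𝒳_V(F), and let y ∈ X^{V∖I} be such that Σ_{u ∈ X^I} g_V^{x̄}(uy) > 0. Then the concatenated boundary condition x̄y belongs to 𝒳_I(F), and for all x, u ∈ X^I one has g_V^{x̄}(xy) · g_I^{x̄y}(u) = g_V^{x̄}(uy) · g_I^{x̄y}(x). -/
open MeasureTheory Filter Topology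

noncomputable section

/-- Sites of the lattice `ℤ^d`. -/
abbrev Site (d : ℕ) := Fin d → ℤ

/-- Configurations on the whole lattice. -/
abbrev Config (d : ℕ) (X : Type*) := Site d → X

variable {d : ℕ} {X : Type*}

/-- The configuration equal to `x` on `V` and to `z` off `V` (the concatenation `xz`). -/
def concat (V : Finset (Site d)) (x z : Config d X) : Config d X :=
  fun t => if t ∈ V then x t else z t

/-- The configuration equal to `u` on `I` and to `y` off `I`. -/
def extCfg (I : Finset (Site d)) (u : {s // s ∈ I} → X) (y : Config d X) : Config d X :=
  fun t => if h : t ∈ I then u ⟨t, h⟩ else y t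

/-- The cylinder set determined by the values of `z` on `Λ`. -/
def cyl (Λ : Finset (Site d)) (z : Config d X) : Set (Config d X) :=
  {ω | ∀ t ∈ Λ, ω t = z t}

/-- Finite-dimensional distribution `P_Λ(z)`. -/
def fdd [MeasurableSpace X] (P : Measure (Config d X)) (Λ : Finset (Site d))
    (z : Config d X) : ℝ :=
  (P (cyl Λ z)).toReal

/-- A positive random field: all finite-dimensional distributions are positive. -/
def IsPositiveRF [MeasurableSpace X] (P : Measure (Config d X)) : Prop :=
  ∀ Λ : Finset (Site d), Λ.Nonempty → ∀ z : Config d X, 0 < fdd P Λ z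

/-- Finite-conditional probability `g_V^z(x)` with boundary condition `z` on `Λ`. -/
def gfin [MeasurableSpace X] (P : Measure (Config d X)) (V Λ : Finset (Site d))
    (x z : Config d X) : ℝ :=
  fdd P (V ∪ Λ) (concat V x z) / fdd P Λ z

/-- A filtration: an increasing sequence of finite subsets of the lattice with union `ℤ^d`. -/
structure Filt (d : ℕ) where
  Λ : ℕ → Finset (Site d)
  mono : Monotone Λ
  covers : ∀ t : Site d, ∃ n, t ∈ Λ n

/-- The set `𝒳_V(F)` of admissible boundary conditions: those `x̄` for which all the limits
`lim_n g_V^{x̄_{Λ_n ∖ V}}(x)` exist. (Only the values of `x̄` off `V` are ever used.) -/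
def admissible [MeasurableSpace X] (P : Measure (Config d X)) (V : Finset (Site d))
    (F : Filt d) : Set (Config d X) :=
  {xb | ∀ x : Config d X, ∃ L : ℝ,
    Tendsto (fun n => gfin P V (F.Λ n \ V) x xb) atTop (𝓝 L)}

/-- The conditional probability `g_V^{x̄}(x)` : the limit of `g_V^{x̄_{Λ_n ∖ V}}(x)`. -/
def gCond [MeasurableSpace X] (P : Measure (Config d X)) (V : Finset (Site d))
    (F : Filt d) (xb x : Config d X) : ℝ :=
  limUnder atTop (fun n => gfin P V (F.Λ n \ V) x xb)

/-- Transition energy `Δ_V^{x̄}(x,u) = ln (g_V^{x̄}(x) / g_V^{x̄}(u))`. -/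
def TE [MeasurableSpace X] (P : Measure (Config d X)) (V : Finset (Site d))
    (F : Filt d) (xb x u : Config d X) : ℝ :=
  Real.log (gCond P V F xb x / gCond P V F xb u)

/-- Quasilocality (on boundary conditions off `V`) of a function `h` on a set `Y` of
boundary conditions. -/
def QuasilocalOn (V : Finset (Site d)) (Y : Set (Config d X)) (h : Config d X → ℝ) : Prop :=
  ∀ ε > 0, ∃ Λε : Finset (Site d), Disjoint Λε V ∧
    ∀ Λ : Finset (Site d), Disjoint Λ V → Λε ⊆ Λ →
      ∀ xb ∈ Y, ∀ yb ∈ Y, (∀ s ∈ Λ, xb s = yb s) → |h xb - h yb| < ε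

/-- `Y` represents a set of boundary conditions on `ℤ^d ∖ {t}`: membership does not depend
on the value at `t`. -/
def IsBCSet (t : Site d) (Y : Set (Config d X)) : Prop :=
  ∀ (ω : Config d X) (a : X), ω ∈ Y → Function.update ω t a ∈ Y

/-- `F` is a determining filtration for `P` with sets `Y t` of admissible boundary conditions:
the one-point finite-conditional probabilities converge, uniformly over `Y t`, to positive
limits, and `P(Y t) = 1`. -/
structure IsDetermining [MeasurableSpace X] (P : Measure (Config d X)) (F : Filt d)
    (Y : Site d → Set (Config d X)) : Prop where
  meas : ∀ t, MeasurableSet (Y t)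
  bc : ∀ t, IsBCSet t (Y t)
  adm : ∀ t, Y t ⊆ admissible P {t} F
  full : ∀ t, P (Y t) = 1
  pos : ∀ t, ∀ xb ∈ Y t, ∀ x : X, 0 < gCond P {t} F xb (fun _ => x)
  unif : ∀ (t : Site d) (x : X), ∀ ε > 0, ∃ N, ∀ n ≥ N, ∀ xb ∈ Y t,
    |gfin P {t} (F.Λ n \ {t}) (fun _ => x) xb - gCond P {t} F xb (fun _ => x)| < ε

/-- The probabilistic (Pr--) definition of a Gibbs random field. -/
def IsGibbsRF [MeasurableSpace X] (P : Measure (Config d X)) : Prop :=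
  IsProbabilityMeasure P ∧ IsPositiveRF P ∧
    ∃ (F : Filt d) (Y : Site d → Set (Config d X)), IsDetermining P F Y

theorem measurableSet_cyl [MeasurableSpace X] [MeasurableSingletonClass X]
    (Λ : Finset (Site d)) (z : Config d X) : MeasurableSet (cyl Λ z) := by
  have h : cyl Λ z = ⋂ t ∈ Λ, (fun ω : Config d X => ω t) ⁻¹' {z t} := by
    ext ω
    simp [cyl]
  rw [h]
  exact Finset.measurableSet_biInter Λ fun t _ =>
    measurable_pi_apply t (measurableSet_singleton _)

theorem fdd_pos [MeasurableSpace X] {P : Measure (Config d X)} [IsProbabilityMeasure P]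
    (hP : IsPositiveRF P) (Λ : Finset (Site d)) (z : Config d X) : 0 < fdd P Λ z := by
  rcases Λ.eq_empty_or_nonempty with rfl | h
  · simp [fdd, cyl]
  · exact hP Λ h z

/-- Consistency of the finite-dimensional distributions. -/
theorem sum_fdd_extCfg [Fintype X] [MeasurableSpace X] [MeasurableSingletonClass X]
    (P : Measure (Config d X)) [IsProbabilityMeasure P] {I Λ : Finset (Site d)} (hI : I ⊆ Λ)
    (w : Config d X) :
    ∑ u : {s // s ∈ I} → X, fdd P Λ (extCfg I u w) = fdd P (Λ \ I) w := by
  have hU : cyl (Λ \ I) w = ⋃ u : {s // s ∈ I} → X, cyl Λ (extCfg I u w) := by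
    ext ω
    simp only [cyl, Set.mem_iUnion, Set.mem_ofPred_eq, Finset.mem_sdiff]
    constructor
    · intro h
      refine ⟨fun s => ω s, fun t ht => ?_⟩
      by_cases hti : t ∈ I
      · simp [extCfg, hti]
      · simpa [extCfg, hti] using h t ⟨ht, hti⟩
    · rintro ⟨u, hu⟩ t ⟨ht, hti⟩
      simpa [extCfg, hti] using hu t ht
  have hdisj : Pairwise (Function.onFun Disjoint
      fun u : {s // s ∈ I} → X => cyl Λ (extCfg I u w)) := by
    refine fun u v huv => Set.disjoint_left.2 fun ω hu hv => huv ?_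
    funext s
    have h1 := hu s (hI s.2)
    have h2 := hv s (hI s.2)
    simp only [extCfg, s.2, dite_true] at h1 h2
    exact h1.symm.trans h2
  unfold fdd
  rw [hU, measure_iUnion hdisj fun u => measurableSet_cyl _ _, tsum_fintype,
    ENNReal.toReal_sum fun u _ => measure_ne_top _ _]

theorem concat_concat_sdiff {I V : Finset (Site d)} (hIV : I ⊆ V) (x y z : Config d X) :
    concat I x (concat (V \ I) y z) = concat V (concat I x y) z := by
  funext t
  have := @hIV t
  by_cases hI : t ∈ I <;> by_cases hV : t ∈ V <;> simp_all [concat]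

theorem extCfg_concat_sdiff {I V : Finset (Site d)} (hIV : I ⊆ V) (u : {s // s ∈ I} → X)
    (y z : Config d X) :
    extCfg I u (concat (V \ I) y z) = concat V (extCfg I u y) z := by
  funext t
  have := @hIV t
  by_cases hI : t ∈ I <;> by_cases hV : t ∈ V <;> simp_all [concat, extCfg]

/-- Conditioning on `V \ I` inside the volume `V`, at the level of finite-conditional
probabilities. -/
theorem gfin_concat_sdiff [Fintype X] [MeasurableSpace X] [MeasurableSingletonClass X]
    {P : Measure (Config d X)} [IsProbabilityMeasure P] (hP : IsPositiveRF P)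
    {I V Λ : Finset (Site d)} (hIV : I ⊆ V) (hV : V ⊆ Λ) (x y z : Config d X) :
    gfin P I (Λ \ I) x (concat (V \ I) y z) =
      gfin P V (Λ \ V) (concat I x y) z /
        ∑ u : {s // s ∈ I} → X, gfin P V (Λ \ V) (extCfg I u y) z := by
  have hne : fdd P (Λ \ V) z ≠ 0 := (fdd_pos hP _ _).ne'
  simp only [gfin, ← Finset.sum_div, Finset.union_sdiff_of_subset hV,
    Finset.union_sdiff_of_subset (hIV.trans hV), concat_concat_sdiff hIV,
    ← extCfg_concat_sdiff hIV, sum_fdd_extCfg P (hIV.trans hV)]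
  rw [div_div_div_cancel_right₀ hne]

theorem tendsto_gfin_gCond [MeasurableSpace X] {P : Measure (Config d X)}
    {V : Finset (Site d)} {F : Filt d} {z : Config d X} (hz : z ∈ admissible P V F)
    (x : Config d X) :
    Tendsto (fun n => gfin P V (F.Λ n \ V) x z) atTop (𝓝 (gCond P V F z x)) :=
  tendsto_nhds_limUnder (hz x)

theorem Filt.eventually_subset (F : Filt d) (V : Finset (Site d)) :
    ∀ᶠ n in atTop, V ⊆ F.Λ n := by
  have h : ∀ᶠ n in atTop, ∀ t ∈ V, t ∈ F.Λ n := by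
    rw [Filter.eventually_all_finset]
    intro t _
    obtain ⟨m, hm⟩ := F.covers t
    filter_upwards [eventually_ge_atTop m] with n hn using F.mono hn hm
  exact h

/-- Proposition 1 / `admiss`. -/
theorem stmt0 [Fintype X] [Nontrivial X] [MeasurableSpace X] [MeasurableSingletonClass X]
    (P : Measure (Config d X)) [IsProbabilityMeasure P] (hP : IsPositiveRF P)
    (F : Filt d) (I V : Finset (Site d)) (hI : I.Nonempty) (hIV : I ⊆ V)
    (xb : Config d X) (hxb : xb ∈ admissible P V F) (y : Config d X)
    (hsum : 0 < ∑ u : {s // s ∈ I} → X, gCond P V F xb (extCfg I u y)) :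
    concat (V \ I) y xb ∈ admissible P I F ∧
      ∀ x u : Config d X,
        gCond P V F xb (concat I x y) * gCond P I F (concat (V \ I) y xb) u =
          gCond P V F xb (concat I u y) * gCond P I F (concat (V \ I) y xb) x := by
  have hlim : ∀ x : Config d X,
      Tendsto (fun n => gfin P I (F.Λ n \ I) x (concat (V \ I) y xb)) atTop
        (𝓝 (gCond P V F xb (concat I x y) /
          ∑ u : {s // s ∈ I} → X, gCond P V F xb (extCfg I u y))) := by
    intro x
    refine ((tendsto_gfin_gCond hxb _).div
      (tendsto_finsetSum _ fun u _ => tendsto_gfin_gCond hxb (extCfg I u y)) hsum.ne').congr' ?_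
    filter_upwards [F.eventually_subset V] with n hn
    exact (gfin_concat_sdiff hP hIV hn x y xb).symm
  refine ⟨fun x => ⟨_, hlim x⟩, fun x u => ?_⟩
  have hg : ∀ v : Config d X, gCond P I F (concat (V \ I) y xb) v = _ :=
    fun v => (hlim v).limUnder_eq
  rw [hg x, hg u]
  ring
end
end

section
/- Let P be a Gibbs random field with determining filtration F = (Λ_n) and corresponding sets of admissible boundary conditions Y_t(F), t ∈ ℤ^d. Then the one-point conditional distributions of P are quasilocal on these sets: for every t ∈ ℤ^d and x ∈ X, the function x̄ ↦ g_t^{x̄}(x) is quasilocal on Y_t(F), i.e., for every ε > 0 there is a finite Λ_ε ⊂ ℤ^d∖{t} such that |g_t^{x̄}(x) − g_t^{ȳ}(x)| < ε for all finite Λ ⊂ ℤ^d∖{t} with Λ ⊇ Λ_ε and all x̄, ȳ ∈ Y_t(F) with x̄_Λ = ȳ_Λ. -/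
open MeasureTheory Filter Topology

noncomputable section

variable {d : ℕ} {X : Type*}

/-- Finite-conditional probabilities depend only on the boundary values they condition on. -/
theorem gfin_congr [MeasurableSpace X] (P : Measure (Config d X)) (V Λ : Finset (Site d))
    (x y z : Config d X) (h : ∀ s ∈ Λ, y s = z s) : gfin P V Λ x y = gfin P V Λ x z := by
  have h₁ : cyl Λ y = cyl Λ z := by
    ext ω
    exact forall₂_congr fun s hs => by rw [h s hs]
  have h₂ : cyl (V ∪ Λ) (concat V x y) = cyl (V ∪ Λ) (concat V x z) := by
    ext ω
    refine forall₂_congr fun s hs => ?_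
    by_cases hV : s ∈ V
    · simp [concat, hV]
    · have hΛ : s ∈ Λ := (Finset.mem_union.mp hs).resolve_left hV
      simp [concat, hV, h s hΛ]
  simp only [gfin, fdd, h₁, h₂]

/-- quasilocality of one-point conditional distributions of a Gibbs random
field on the sets of admissible boundary conditions, relation (11) / `quasilocY`. -/
theorem stmt8 [Fintype X] [Nontrivial X] [MeasurableSpace X] [MeasurableSingletonClass X]
    (P : Measure (Config d X)) [IsProbabilityMeasure P] (hP : IsPositiveRF P)
    (F : Filt d) (Y : Site d → Set (Config d X)) (hdet : IsDetermining P F Y) :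
    ∀ (t : Site d) (x : X),
      QuasilocalOn {t} (Y t) (fun xb => gCond P {t} F xb (fun _ => x)) := by
  intro t x ε hε
  obtain ⟨N, hN⟩ := hdet.unif t x (ε / 2) (half_pos hε)
  refine ⟨F.Λ N \ {t}, Finset.sdiff_disjoint, fun Λ _ hsub xb hx yb hy hxy => ?_⟩
  have hxN := abs_lt.mp (hN N le_rfl xb hx)
  have hyN := abs_lt.mp (hN N le_rfl yb hy)
  rw [gfin_congr P {t} (F.Λ N \ {t}) _ xb yb fun s hs => hxy s (hsub hs)] at hxN
  rw [abs_lt]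
  constructor <;> linarith [hxN.1, hxN.2, hyN.1, hyN.2]
end
end

section
/- Let P be a positive random field on X^{ℤ^d}. Suppose there exists a filtration F such that for each t ∈ ℤ^d there is a measurable set of admissible boundary conditions Y_t(F) ⊆ 𝒳_t(F) with P{ω : the restriction of ω to ℤ^d∖{t} lies in Y_t(F)} = 1, on which for every x ∈ X the function x̄ ↦ g_t^{x̄}(x) is quasilocal, and g_t^{x̄}(x) > 0 for every x̄ ∈ Y_t(F) and x ∈ X. Then P is a Gibbs random field. -/
open MeasureTheory Filter Topology

noncomputable section

variable {d : ℕ} {X : Type*}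

lemma cyl_eq_preimage_restrict (A : Finset (Site d)) (z : Config d X) :
    cyl A z = A.restrict (π := fun _ => X) ⁻¹' {A.restrict z} := by
  ext ω
  simp only [cyl, Set.mem_ofPred_eq, Set.mem_preimage, Set.mem_singleton_iff, funext_iff,
    Finset.restrict, Subtype.forall]

lemma cyl_insert_concat {t : Site d} {A : Finset (Site d)} (ht : t ∉ A) (x : X)
    (z : Config d X) :
    cyl ({t} ∪ A) (concat {t} (fun _ => x) z) = {ω | ω t = x} ∩ cyl A z := by
  ext ω
  simp only [cyl, concat, Set.mem_ofPred_eq, Set.mem_inter_iff, Finset.mem_union,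
    Finset.mem_singleton]
  constructor
  · refine fun h => ⟨by simpa using h t (Or.inl rfl), fun s hs => ?_⟩
    have hst : s ≠ t := fun e => ht (e ▸ hs)
    simpa [hst] using h s (Or.inr hs)
  · rintro ⟨h₁, h₂⟩ s hs
    split_ifs with e
    · rw [e, h₁]
    · exact h₂ s (hs.resolve_left e)

/-- A one-point finite-conditional probability as an elementary conditional probability given
the restriction to `A`. -/
lemma gfin_eq_div [MeasurableSpace X] (P : Measure (Config d X)) {t : Site d}
    {A : Finset (Site d)} (ht : t ∉ A) (x : X) (z : Config d X) :
    gfin P {t} A (fun _ => x) z =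
      P.real ({ω | ω t = x} ∩ A.restrict (π := fun _ => X) ⁻¹' {A.restrict z}) /
        P.real (A.restrict (π := fun _ => X) ⁻¹' {A.restrict z}) := by
  simp only [gfin, fdd, cyl_insert_concat ht, cyl_eq_preimage_restrict, Measure.real]

lemma abs_gfin_le_one [MeasurableSpace X] (P : Measure (Config d X)) [IsProbabilityMeasure P]
    {t : Site d} {A : Finset (Site d)} (ht : t ∉ A) (x : X) (z : Config d X) :
    |gfin P {t} A (fun _ => x) z| ≤ 1 := by
  rw [gfin_eq_div P ht, abs_of_nonneg (by positivity)]
  exact div_le_one_of_le₀ (measureReal_mono Set.inter_subset_right) measureReal_nonneg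

/-- Averaging elementary conditional probabilities of `E` given a map into a finite space
recovers the joint probabilities. -/
lemma setIntegral_elementary_condProb {Ω α : Type*} [MeasurableSpace Ω] [Fintype α]
    [MeasurableSpace α] [MeasurableSingletonClass α] (P : Measure Ω) [IsFiniteMeasure P]
    {r : Ω → α} (hr : Measurable r) (E : Set Ω) (S : Set α) :
    ∫ ω in r ⁻¹' S, P.real (E ∩ r ⁻¹' {r ω}) / P.real (r ⁻¹' {r ω}) ∂P =
      P.real (E ∩ r ⁻¹' S) := by
  classical
  have hS : MeasurableSet S := S.toFinite.measurableSet
  rw [← setIntegral_map (f := fun u => P.real (E ∩ r ⁻¹' {u}) / P.real (r ⁻¹' {u})) hS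
    (measurable_of_finite _).aestronglyMeasurable hr.aemeasurable]
  have hE : ∀ T : Set α, P.real (E ∩ r ⁻¹' T) = ((P.restrict E).map r).real T := fun T => by
    have hT : MeasurableSet T := T.toFinite.measurableSet
    rw [map_measureReal_apply hr hT, measureReal_restrict_apply (hr hT), Set.inter_comm]
  rw [hE S, ← Set.coe_toFinset S, setIntegral_finset _ (Integrable.of_finite).integrableOn,
    ← sum_measureReal_singleton]
  refine Finset.sum_congr rfl fun u _ => ?_
  rw [map_measureReal_apply hr (measurableSet_singleton u), ← hE, smul_eq_mul]
  refine mul_div_cancel_of_imp' fun h => ?_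
  exact measureReal_mono_null Set.inter_subset_right h

section RandomField

variable [Fintype X] [MeasurableSpace X] [MeasurableSingletonClass X]
  (P : Measure (Config d X))

lemma measurable_gfin {t : Site d} {A : Finset (Site d)} (ht : t ∉ A) (x : X) :
    Measurable (fun ω => gfin P {t} A (fun _ => x) ω) := by
  simp only [gfin_eq_div P ht]
  exact (measurable_of_finite fun u : A → X =>
      P.real ({ω | ω t = x} ∩ A.restrict (π := fun _ => X) ⁻¹' {u}) /
        P.real (A.restrict (π := fun _ => X) ⁻¹' {u})).comp (Finset.measurable_restrict A)

variable [IsProbabilityMeasure P]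

lemma setIntegral_gfin {t : Site d} {A B : Finset (Site d)} (hAB : A ⊆ B) (ht : t ∉ B)
    (x : X) (z : Config d X) :
    ∫ ω in cyl A z, gfin P {t} B (fun _ => x) ω ∂P = P.real ({ω | ω t = x} ∩ cyl A z) := by
  have hcyl : cyl A z = B.restrict ⁻¹' {u | ∀ s (hs : s ∈ A), u ⟨s, hAB hs⟩ = z s} := rfl
  simp only [gfin_eq_div P ht, hcyl]
  exact setIntegral_elementary_condProb P (Finset.measurable_restrict B) _ _

/-- If the limiting conditional probability stays within `ε` of `c` almost everywhere on a
cylinder, then so does the finite-conditional probability given that cylinder. -/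
lemma abs_gfin_sub_le (F : Filt d) {t : Site d} {x : X} {z : Config d X} {m : ℕ} {c ε : ℝ}
    {h : Config d X → ℝ} (hz : 0 < P.real (cyl (F.Λ m \ {t}) z))
    (hlim : ∀ᵐ ω ∂P,
      Tendsto (fun n => gfin P {t} (F.Λ n \ {t}) (fun _ => x) ω) atTop (𝓝 (h ω)))
    (hclose : ∀ᵐ ω ∂P, ω ∈ cyl (F.Λ m \ {t}) z → |h ω - c| ≤ ε) :
    |gfin P {t} (F.Λ m \ {t}) (fun _ => x) z - c| ≤ ε := by
  have ht : ∀ n, t ∉ F.Λ n \ {t} := fun n => by simp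
  have hlim' : Tendsto (fun n => ∫ ω in cyl (F.Λ m \ {t}) z,
      (gfin P {t} (F.Λ n \ {t}) (fun _ => x) ω - c) ∂P) atTop
      (𝓝 (∫ ω in cyl (F.Λ m \ {t}) z, (h ω - c) ∂P)) := by
    refine tendsto_integral_of_dominated_convergence (fun _ => 1 + |c|)
      (fun n => ((measurable_gfin P (ht n) x).sub_const c).aestronglyMeasurable)
      (integrable_const _) (fun n => ae_of_all _ fun ω => ?_)
      (ae_restrict_of_ae (hlim.mono fun ω hω => hω.sub_const c))
    exact (abs_sub _ _).trans (by gcongr; exact abs_gfin_le_one P (ht n) x ω)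
  have hconst : ∀ n ≥ m, ∫ ω in cyl (F.Λ m \ {t}) z,
      (gfin P {t} (F.Λ n \ {t}) (fun _ => x) ω - c) ∂P =
      P.real (cyl (F.Λ m \ {t}) z) * (gfin P {t} (F.Λ m \ {t}) (fun _ => x) z - c) := by
    intro n hn
    have hint : Integrable (fun ω => gfin P {t} (F.Λ n \ {t}) (fun _ => x) ω)
        (P.restrict (cyl (F.Λ m \ {t}) z)) :=
      .of_bound (measurable_gfin P (ht n) x).aestronglyMeasurable 1
        (ae_of_all _ fun ω => abs_gfin_le_one P (ht n) x ω)
    rw [integral_sub hint (integrable_const c),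
      setIntegral_gfin P (Finset.sdiff_subset_sdiff (F.mono hn) subset_rfl) (ht n),
      setIntegral_const, gfin_eq_div P (ht m), ← cyl_eq_preimage_restrict, smul_eq_mul, mul_sub,
      mul_div_cancel₀ _ hz.ne']
  have heq := tendsto_nhds_unique hlim'
    (tendsto_const_nhds.congr' (eventually_atTop.2 ⟨m, fun n hn => (hconst n hn).symm⟩))
  have hbound := norm_setIntegral_le_of_norm_le_const_ae' (f := fun ω => h ω - c)
    (measure_lt_top P _) hclose
  rw [heq, norm_mul, Real.norm_of_nonneg hz.le, mul_comm] at hbound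
  exact le_of_mul_le_mul_right hbound hz

end RandomField

/-- Theorem 4 / `crit-Gibbs-1`, direct part: quasilocal positive one-point
conditional distributions on full-measure sets of admissible boundary conditions imply
Gibbsianness. -/
theorem stmt11 [Fintype X] [Nontrivial X] [MeasurableSpace X] [MeasurableSingletonClass X]
    (P : Measure (Config d X)) [IsProbabilityMeasure P] (hP : IsPositiveRF P)
    (F : Filt d) (Y : Site d → Set (Config d X))
    (hmeas : ∀ t, MeasurableSet (Y t)) (hbc : ∀ t, IsBCSet t (Y t))
    (hadm : ∀ t, Y t ⊆ admissible P {t} F) (hfull : ∀ t, P (Y t) = 1)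
    (hql : ∀ (t : Site d) (x : X),
      QuasilocalOn {t} (Y t) (fun xb => gCond P {t} F xb (fun _ => x)))
    (hpos : ∀ t, ∀ xb ∈ Y t, ∀ x : X, 0 < gCond P {t} F xb (fun _ => x)) :
    IsGibbsRF P := by
  refine ⟨inferInstance, hP, F, Y, hmeas, hbc, hadm, hfull, hpos, fun t x ε hε => ?_⟩
  obtain ⟨K, hKt, hK⟩ := hql t x (ε / 2) (half_pos hε)
  have hcover : ∀ᶠ n in atTop, ∀ s ∈ K, s ∈ F.Λ n :=
    (Filter.eventually_all_finset K).2 fun s _ =>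
      let ⟨k, hk⟩ := F.covers s
      eventually_atTop.2 ⟨k, fun n hn => F.mono hn hk⟩
  obtain ⟨N, hN⟩ := eventually_atTop.1 hcover
  refine ⟨N, fun n hn xb hxb => lt_of_le_of_lt ?_ (half_lt_self hε)⟩
  have hY : ∀ᵐ ω ∂P, ω ∈ Y t := (mem_ae_iff_prob_eq_one (hmeas t)).2 (hfull t)
  have hcyl : 0 < P.real (cyl (F.Λ n \ {t}) xb) := by
    rcases (F.Λ n \ {t}).eq_empty_or_nonempty with h | h
    · simp [h, cyl]
    · exact hP _ h xb
  refine abs_gfin_sub_le P F hcyl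
    (h := fun ω => gCond P {t} F ω (fun _ => x)) (hY.mono fun ω hω => ?_)
    (hY.mono fun ω hω hωcyl => ?_)
  · exact tendsto_nhds_limUnder (hadm t hω fun _ => x)
  · refine (hK (F.Λ n \ {t}) Finset.sdiff_disjoint (fun s hs => ?_) ω hω xb hxb hωcyl).le
    exact Finset.mem_sdiff.2 ⟨hN n hn s hs, Finset.disjoint_left.1 hKt hs⟩
end
end
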